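/- Fix s₀ > 0 and for an integer k ≥ 1 set t_k = s₀(2^{2k} − 1). Let f : ℝ² → ℂ be integrable and define the Gaussian pyramid p_n(x) = (G(·, t_n) ⋆ f)(2ⁿ x) for integers n ≥ 1. Then for all integers m ≥ 1, n ≥ 1 and every x ∈ ℝ²: (G(·, t_m) ⋆ p_n)(2^m x) = p_{m+n}(x); that is, applying the jumping action S_m (Gaussian blur with variance t_m followed by subsampling by 2^m) to level n of the Gaussian pyramid yields level m+n: S_m[p_n] = p_{m+n}. -/

import Mathlib

open MeasureTheory

/-- The 2-D Gauss–Weierstrass kernel `G(x, t) = (4πt)⁻¹ exp(−‖x‖²/(4t))`. -/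
noncomputable def gaussKernel (x : EuclideanSpace ℝ (Fin 2)) (t : ℝ) : ℝ :=
  (4 * Real.pi * t)⁻¹ * Real.exp (-‖x‖ ^ 2 / (4 * t))

/-- Convolution `(g ⋆ f)(x) = ∫ g(y) f(x − y) dy` on `ℝ²`. -/
noncomputable def conv (g f : EuclideanSpace ℝ (Fin 2) → ℂ)
    (x : EuclideanSpace ℝ (Fin 2)) : ℂ :=
  ∫ y, g y * f (x - y)

/-- `t_k = s₀ (2^{2k} − 1)`. -/
noncomputable def tvar (s₀ : ℝ) (k : ℕ) : ℝ := s₀ * (2 ^ (2 * k) - 1)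

/-- Gaussian pyramid level `n`: `p_n(x) = (G(·, t_n) ⋆ f)(2ⁿ x)`. -/
noncomputable def pyramid (s₀ : ℝ) (f : EuclideanSpace ℝ (Fin 2) → ℂ) (n : ℕ)
    (x : EuclideanSpace ℝ (Fin 2)) : ℂ :=
  conv (fun y => (gaussKernel y (tvar s₀ n) : ℂ)) f ((2 ^ n : ℝ) • x)

theorem continuous_gaussKernel (t : ℝ) : Continuous (gaussKernel · t) := by
  unfold gaussKernel
  fun_prop

theorem gaussKernel_nonneg {t : ℝ} (ht : 0 ≤ t) (x : EuclideanSpace ℝ (Fin 2)) :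
    0 ≤ gaussKernel x t := by
  unfold gaussKernel
  positivity

theorem gaussKernel_le {t : ℝ} (ht : 0 ≤ t) (x : EuclideanSpace ℝ (Fin 2)) :
    gaussKernel x t ≤ (4 * Real.pi * t)⁻¹ := by
  refine mul_le_of_le_one_right (by positivity) (Real.exp_le_one_iff.2 ?_)
  exact div_nonpos_of_nonpos_of_nonneg (neg_nonpos.2 (by positivity)) (by positivity)

theorem gaussKernel_smul {c : ℝ} (hc : c ≠ 0) (t : ℝ) (x : EuclideanSpace ℝ (Fin 2)) :
    gaussKernel (c • x) (c ^ 2 * t) = (c ^ 2)⁻¹ * gaussKernel x t := by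
  unfold gaussKernel
  rw [norm_smul, mul_pow, Real.norm_eq_abs, sq_abs, ← mul_assoc (c ^ 2)⁻¹, ← mul_inv,
    mul_left_comm (4 : ℝ), ← mul_neg, mul_div_mul_left _ _ (pow_ne_zero 2 hc),
    mul_left_comm (4 * Real.pi)]

theorem integrable_gaussKernel {t : ℝ} (ht : 0 < t) :
    Integrable (fun x => (gaussKernel x t : ℂ)) := by
  have hb : 0 < ((1 / (4 * t) : ℝ) : ℂ).re := by
    rw [Complex.ofReal_re]
    positivity
  convert! (GaussianFourier.integrable_cexp_neg_mul_sq_norm_add hb 0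
    (0 : EuclideanSpace ℝ (Fin 2))).const_mul (((4 * Real.pi * t)⁻¹ : ℝ) : ℂ) using 2 with x
  rw [gaussKernel]
  push_cast
  congr 2
  ring

/-- The Gauss–Weierstrass kernels form a convolution semigroup. -/
theorem conv_gaussKernel_gaussKernel {s t : ℝ} (hs : 0 < s) (ht : 0 < t)
    (x : EuclideanSpace ℝ (Fin 2)) :
    conv (fun y => (gaussKernel y s : ℂ)) (fun y => (gaussKernel y t : ℂ)) x
      = gaussKernel x (s + t) := by
  have hb : 0 < (((s + t) / (4 * s * t) : ℝ) : ℂ).re := by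
    rw [Complex.ofReal_re]
    positivity
  have hs' : (s : ℂ) ≠ 0 := by exact_mod_cast hs.ne'
  have ht' : (t : ℂ) ≠ 0 := by exact_mod_cast ht.ne'
  have hst : (s : ℂ) + t ≠ 0 := by exact_mod_cast (add_pos hs ht).ne'
  have key (y : EuclideanSpace ℝ (Fin 2)) :
      (gaussKernel y s : ℂ) * (gaussKernel (x - y) t : ℂ) =
        ((4 * Real.pi * s)⁻¹ * (4 * Real.pi * t)⁻¹ * Complex.exp (-‖x‖ ^ 2 / (4 * t))) *
          Complex.exp (-(((s + t) / (4 * s * t) : ℝ) : ℂ) * ‖y‖ ^ 2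
            + 1 / (2 * t) * (inner ℝ x y : ℝ)) := by
    rw [gaussKernel, gaussKernel, norm_sub_sq_real]
    push_cast
    rw [mul_mul_mul_comm, mul_assoc _ (Complex.exp _), ← Complex.exp_add, ← Complex.exp_add]
    congr 2
    field_simp
    ring
  simp only [conv, key]
  rw [integral_const_mul, GaussianFourier.integral_cexp_neg_mul_sq_norm_add hb, gaussKernel,
    finrank_euclideanSpace_fin]
  push_cast
  rw [div_self two_ne_zero, Complex.cpow_one, mul_mul_mul_comm, ← Complex.exp_add]
  congr 1
  · field_simp
  · congr 1
    field_simp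
    ring

theorem conv_eq_convolution (g f : EuclideanSpace ℝ (Fin 2) → ℂ) :
    conv g f = convolution g f (ContinuousLinearMap.mul ℂ ℂ) volume := rfl

theorem conv_gaussKernel_conv_gaussKernel {s t : ℝ} (hs : 0 < s) (ht : 0 < t)
    {f : EuclideanSpace ℝ (Fin 2) → ℂ} (hf : Integrable f) (x : EuclideanSpace ℝ (Fin 2)) :
    conv (fun y => (gaussKernel y s : ℂ)) (conv (fun y => (gaussKernel y t : ℂ)) f) x
      = conv (fun y => (gaussKernel y (s + t) : ℂ)) f x := by
  have hgs := integrable_gaussKernel hs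
  have hgt := integrable_gaussKernel ht
  rw [← funext (conv_gaussKernel_gaussKernel hs ht)]
  simp only [conv_eq_convolution]
  refine (convolution_assoc _ _ _ _ (fun a b c => mul_assoc a b c) hgs.aestronglyMeasurable
    hgt.aestronglyMeasurable hf.aestronglyMeasurable (hgs.ae_convolution_exists _ hgt)
    (hgt.norm.ae_convolution_exists _ hf.norm) ?_).symm
  refine ((hgt.norm.integrable_convolution (ContinuousLinearMap.mul ℝ ℝ)
    hf.norm).comp_sub_left x).bdd_mul (c := (4 * Real.pi * s)⁻¹) hgs.norm.aestronglyMeasurable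
    (.of_forall fun y => ?_)
  rw [norm_norm, Complex.norm_real, Real.norm_of_nonneg (gaussKernel_nonneg hs.le y)]
  exact gaussKernel_le hs.le y

/-- Blurring a dilated function amounts to blurring the function with the rescaled variance. -/
theorem conv_gaussKernel_comp_smul {c : ℝ} (hc : c ≠ 0) (t : ℝ)
    (g : EuclideanSpace ℝ (Fin 2) → ℂ) (x : EuclideanSpace ℝ (Fin 2)) :
    conv (fun y => (gaussKernel y t : ℂ)) (fun y => g (c • y)) x
      = conv (fun y => (gaussKernel y (c ^ 2 * t) : ℂ)) g (c • x) := by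
  have hc' : (c : ℂ) ≠ 0 := by exact_mod_cast hc
  have key (y : EuclideanSpace ℝ (Fin 2)) : (gaussKernel y t : ℂ) * g (c • (x - y)) =
      (c : ℂ) ^ 2 * ((gaussKernel (c • y) (c ^ 2 * t) : ℂ) * g (c • x - c • y)) := by
    rw [gaussKernel_smul hc, smul_sub]
    push_cast
    field_simp
  simp only [conv, key]
  rw [integral_const_mul, Measure.integral_comp_smul volume
    (fun y => (gaussKernel y (c ^ 2 * t) : ℂ) * g (c • x - y)), finrank_euclideanSpace_fin,
    abs_of_nonneg (by positivity), Complex.real_smul]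
  push_cast
  field_simp

theorem tvar_pos {s₀ : ℝ} (hs₀ : 0 < s₀) {k : ℕ} (hk : 1 ≤ k) : 0 < tvar s₀ k :=
  mul_pos hs₀ (sub_pos.2 (one_lt_pow₀ one_lt_two (by omega)))

theorem tvar_add (s₀ : ℝ) (m n : ℕ) :
    tvar s₀ (m + n) = (2 ^ n) ^ 2 * tvar s₀ m + tvar s₀ n := by
  unfold tvar
  ring

theorem jump_pyramid (s₀ : ℝ) (hs₀ : 0 < s₀) (f : EuclideanSpace ℝ (Fin 2) → ℂ)
    (hf : Integrable f) (m n : ℕ) (hm : 1 ≤ m) (hn : 1 ≤ n)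
    (x : EuclideanSpace ℝ (Fin 2)) :
    conv (fun y => (gaussKernel y (tvar s₀ m) : ℂ)) (pyramid s₀ f n) ((2 ^ m : ℝ) • x)
      = pyramid s₀ f (m + n) x := by
  have hm' : 0 < ((2 : ℝ) ^ n) ^ 2 * tvar s₀ m := mul_pos (by positivity) (tvar_pos hs₀ hm)
  unfold pyramid
  rw [conv_gaussKernel_comp_smul (by positivity),
    conv_gaussKernel_conv_gaussKernel hm' (tvar_pos hs₀ hn) hf, tvar_add, smul_smul,
    ← pow_add, add_comm n m]
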